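/- Let f : [0,T] × ℝⁿ → ℝⁿ satisfy Assumptions (ii) and (iii), and let g : ℝⁿ → ℝ^{n×m} and h : ℝⁿ → ℝ^m be smooth functions. If for each 1 ≤ i ≤ m the set-valued map x ↦ {g_{•i}(x)·σ : σ ∈ sgn(h_i(x))} from ℝⁿ to ℝⁿ is hypomonotone (where g_{•i}(x) denotes the i-th column of g(x)), then for every initial condition x₀ ∈ ℝⁿ the differential inclusion ẋ(t) ∈ f(t, x(t)) - g(x(t))·Sgn(h(x(t))) a.e. on (0,T), x(0) = x₀, has a unique Lipschitz solution x : [0,T] → ℝⁿ. -/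

import Mathlib

open MeasureTheory Set
open scoped RealInnerProductSpace

noncomputable section

/-- The set-valued sign function: `sgn(x) = {1}` if `x > 0`, `{-1}` if `x < 0`,
and `[-1,1]` if `x = 0`. -/
def sgnSet (x : ℝ) : Set ℝ := if 0 < x then {1} else if x < 0 then {-1} else Icc (-1) 1

/-- Matrix-vector product, as a map between Euclidean spaces. -/
def mv {m n : ℕ} (M : Matrix (Fin m) (Fin n) ℝ) (x : EuclideanSpace ℝ (Fin n)) :
    EuclideanSpace ℝ (Fin m) := WithLp.toLp 2 fun i => ∑ j, M i j * x j

/-- A Lipschitz solution on `[0,T]` of the differential inclusion `ẋ(t) ∈ F(t, x(t))`,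
`x(0) = x₀`. -/
def IsLipschitzSolution {E : Type*} [NormedAddCommGroup E] [NormedSpace ℝ E]
    (F : ℝ → E → Set E) (T : ℝ) (x₀ : E) (x : ℝ → E) : Prop :=
  (∃ K : NNReal, LipschitzOnWith K x (Icc 0 T)) ∧ x 0 = x₀ ∧
    ∀ᵐ t ∂volume, t ∈ Ioo 0 T → ∃ v ∈ F t (x t), HasDerivAt x v t

/-- Assumption (ii): `f` is Lipschitz in its second argument, uniformly in `t ∈ [0,T]`. -/
def AssumptionII {E : Type*} [NormedAddCommGroup E] (T : ℝ) (f : ℝ → E → E) : Prop :=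
  ∃ L : ℝ, 0 ≤ L ∧ ∀ t ∈ Icc (0 : ℝ) T, ∀ x₁ x₂ : E, ‖f t x₁ - f t x₂‖ ≤ L * ‖x₁ - x₂‖

/-- Assumption (iii): `f(·,x)` is differentiable in `t` and `Φ(R) < ∞` for every `R ≥ 0`. -/
def AssumptionIII {E : Type*} [NormedAddCommGroup E] [NormedSpace ℝ E]
    (T : ℝ) (f : ℝ → E → E) : Prop :=
  (∀ x : E, Differentiable ℝ fun t => f t x) ∧
  ∀ R : ℝ, 0 ≤ R → ∃ M : ℝ,
    ∀ v : ℝ → E, eLpNorm v 2 (volume.restrict (Ioo 0 T)) ≤ ENNReal.ofReal R →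
      eLpNorm (fun t => deriv (fun τ => f τ (v t)) t) 2 (volume.restrict (Ioo 0 T)) ≤
        ENNReal.ofReal M

/-- A set-valued map `F : ℝⁿ ⇉ ℝⁿ` is hypomonotone if for some constant `k ≥ 0`,
`⟨u - v, x - y⟩ ≥ -k‖x - y‖²` for all selections. -/
def Hypomonotone {n : ℕ}
    (F : EuclideanSpace ℝ (Fin n) → Set (EuclideanSpace ℝ (Fin n))) : Prop :=
  ∃ k : ℝ, 0 ≤ k ∧ ∀ x y u v : EuclideanSpace ℝ (Fin n),
    u ∈ F x → v ∈ F y → -(k * ‖x - y‖ ^ 2) ≤ ⟪u - v, x - y⟫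
/-- The componentwise set-valued sign function `Sgn : ℝᵐ ⇉ ℝᵐ`. -/
def SgnSet {m : ℕ} (y : EuclideanSpace ℝ (Fin m)) : Set (EuclideanSpace ℝ (Fin m)) :=
  {s | ∀ i, s i ∈ sgnSet (y i)}

/-- The `i`-th column of a matrix, as a Euclidean vector. -/
def col {n m : ℕ} (M : Matrix (Fin n) (Fin m) ℝ) (i : Fin m) : EuclideanSpace ℝ (Fin n) :=
  WithLp.toLp 2 fun j => M j i

lemma ac_le_of_ae_deriv_nonpos {T : ℝ} {φ : ℝ → ℝ}
    (hφ : AbsolutelyContinuousOnInterval φ 0 T)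
    (hd : ∀ᵐ t ∂volume, t ∈ Ioo 0 T → ∃ d, HasDerivAt φ d t ∧ d ≤ 0) :
    ∀ t ∈ Icc 0 T, φ t ≤ φ 0 := by
  intro t ht
  have h1 : AbsolutelyContinuousOnInterval φ 0 t := by
    apply hφ.mono
    rw [uIcc_of_le ht.1, uIcc_of_le (ht.1.trans ht.2)]
    exact Icc_subset_Icc le_rfl ht.2
  have h2 := h1.integral_deriv_eq_sub
  have h3 : ∫ s in (0:ℝ)..t, deriv φ s ≤ 0 := by
    rw [intervalIntegral.integral_of_le ht.1]
    rw [integral_Ioc_eq_integral_Ioo]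
    apply integral_nonpos_of_ae
    rw [Filter.EventuallyLE, ae_restrict_iff' measurableSet_Ioo]
    filter_upwards [hd] with s hs hs'
    obtain ⟨d, h1, h2⟩ := hs ⟨hs'.1, hs'.2.trans_le ht.2⟩
    rw [h1.deriv]; exact h2
  linarith

lemma gronwall_ae {E : Type*} [NormedAddCommGroup E] [InnerProductSpace ℝ E]
    {T : ℝ} (hT : 0 < T) {x : ℝ → E} {K : NNReal}
    (hx : LipschitzOnWith K x (Icc 0 T)) (c b : ℝ)
    (hd : ∀ᵐ t ∂volume, t ∈ Ioo 0 T → ∃ v, HasDerivAt x v t ∧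
      ⟪v, x t⟫ ≤ c * (‖x t‖ ^ 2 + b)) :
    ∀ t ∈ Icc 0 T, ‖x t‖ ^ 2 + b ≤ Real.exp (2 * c * t) * (‖x 0‖ ^ 2 + b) := by
  intro t ht
  have hN : AbsolutelyContinuousOnInterval (fun t => ‖x t‖) 0 T := by
    apply LipschitzOnWith.absolutelyContinuousOnInterval (K := 1 * K)
    rw [uIcc_of_le hT.le]
    exact lipschitzWith_one_norm.comp_lipschitzOnWith hx
  have hC : AbsolutelyContinuousOnInterval (fun _ : ℝ => b) 0 T :=
    (contDiff_const (n := 1)).contDiffOn.absolutelyContinuousOnInterval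
  have hE : AbsolutelyContinuousOnInterval (fun t : ℝ => Real.exp (-(2 * c * t))) 0 T :=
    (by fun_prop : ContDiff ℝ 1 (fun t : ℝ => Real.exp (-(2 * c * t)))).contDiffOn.absolutelyContinuousOnInterval
  have hA : AbsolutelyContinuousOnInterval
      (fun t : ℝ => Real.exp (-(2 * c * t)) * (‖x t‖ * ‖x t‖ + b)) 0 T :=
    hE.mul ((hN.mul hN).add hC)
  have := ac_le_of_ae_deriv_nonpos hA ?_ t ht
  · simp only [mul_zero, neg_zero, Real.exp_zero, one_mul] at this
    have h2 := mul_le_mul_of_nonneg_left this (Real.exp_pos (2 * c * t)).le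
    rw [← mul_assoc, ← Real.exp_add] at h2
    simp only [add_neg_cancel, Real.exp_zero, one_mul, ← pow_two] at h2
    exact h2
  · filter_upwards [hd] with s hs hs'
    obtain ⟨v, hv, hle⟩ := hs hs'
    have h1 : HasDerivAt (fun t => ‖x t‖ * ‖x t‖ + b) (2 * ⟪v, x s⟫) s := by
      have := (hv.inner ℝ hv).add_const b
      simp only [real_inner_self_eq_norm_mul_norm] at this
      convert! this using 1
      rw [real_inner_comm v (x s)]; ring
    have h2 : HasDerivAt (fun t : ℝ => Real.exp (-(2 * c * t)))
        (Real.exp (-(2 * c * s)) * (-(2 * c * 1))) s :=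
      (((hasDerivAt_id s).const_mul (2 * c)).neg).exp
    refine ⟨_, h2.mul h1, ?_⟩
    have : Real.exp (-(2 * c * s)) * (-(2 * c * 1)) * (‖x s‖ * ‖x s‖ + b) +
      Real.exp (-(2 * c * s)) * (2 * ⟪v, x s⟫) =
      Real.exp (-(2 * c * s)) * (2 * (⟪v, x s⟫ - c * (‖x s‖ ^ 2 + b))) := by ring
    rw [this]
    apply mul_nonpos_of_nonneg_of_nonpos (Real.exp_pos _).le
    linarith

lemma exists_limit_solution {E : Type*} [NormedAddCommGroup E] [NormedSpace ℝ E]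
    [FiniteDimensional ℝ E] {T : ℝ} (hT : 0 < T) (F : ℕ → ℝ → E → E) (C : NNReal)
    (hb : ∀ k, ∀ t ∈ Icc 0 T, ∀ x, ‖F k t x‖ ≤ C)
    (hL : ∀ k, ∃ K : NNReal, ∀ t ∈ Icc 0 T, LipschitzWith K (F k t))
    (hc : ∀ k x, ContinuousOn (fun t => F k t x) (Icc 0 T))
    (S : ℝ → E → Set E) (hcv : ∀ t x, Convex ℝ (S t x)) (hcl : ∀ t x, IsClosed (S t x))
    (hU : ∀ t ∈ Ioo 0 T, ∀ z, ∀ l : StrongDual ℝ E, ∀ u : ℝ, (∀ w ∈ S t z, l w < u) →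
      ∀ᶠ p : (ℝ × E) × ℕ in (nhds (t, z)) ×ˢ Filter.atTop, l (F p.2 p.1.1 p.1.2) < u)
    (x₀ : E) : ∃ x, IsLipschitzSolution S T x₀ x := by
  have : CompleteSpace E := FiniteDimensional.complete ℝ E
  have : ProperSpace E := FiniteDimensional.proper ℝ E
  have hsol : ∀ k, ∃ α : ℝ → E, α 0 = x₀ ∧
      ∀ t ∈ Icc 0 T, HasDerivWithinAt α (F k t (α t)) (Icc 0 T) t := by
    intro k
    obtain ⟨K, hK⟩ := hL k
    have hPL : IsPicardLindelof (F k) (tmin := 0) (tmax := T) ⟨0, by simp [hT.le]⟩ x₀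
        (C * ⟨T, hT.le⟩) 0 C K :=
      { lipschitzOnWith := fun t ht => (hK t ht).lipschitzOnWith
        continuousOn := fun x _ => hc k x
        norm_le := fun t ht x _ => hb k t ht x
        mul_max_le := by
          simp only [sub_zero, sub_self, max_eq_left hT.le, NNReal.coe_zero]
          exact le_of_eq rfl }
    exact hPL.exists_eq_forall_mem_Icc_hasDerivWithinAt₀
  choose X hX0 hXd using hsol
  have hXL : ∀ k, LipschitzOnWith C (X k) (Icc 0 T) := fun k =>
    (convex_Icc 0 T).lipschitzOnWith_of_nnnorm_hasDerivWithin_le (hXd k)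
      (fun t ht => hb k t ht _)
  set U : Ultrafilter ℕ := Filter.hyperfilter ℕ with hUdef
  have hUat : (U : Filter ℕ) ≤ Filter.atTop := by
    rw [← Nat.cofinite_eq_atTop]; exact Filter.hyperfilter_le_cofinite
  have hlim : ∀ t ∈ Icc 0 T, ∃ y, Filter.Tendsto (fun k => X k t) U (nhds y) := by
    intro t ht
    have h0 : (0:ℝ) ∈ Icc 0 T := ⟨le_rfl, hT.le⟩
    obtain ⟨y, -, hy⟩ := (isCompact_closedBall x₀ (C * T)).ultrafilter_le_nhds
      (U.map (fun k => X k t)) (by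
        rw [Filter.le_principal_iff]
        apply Filter.mem_map.2
        apply Filter.univ_mem'
        intro k
        simp only [mem_preimage, Metric.mem_closedBall]
        have := (hXL k).dist_le_mul t ht 0 h0
        rw [hX0] at this
        refine this.trans ?_
        gcongr
        simp [abs_of_nonneg ht.1, ht.2])
    exact ⟨y, hy⟩
  choose! x hx using hlim
  have hxL : LipschitzOnWith C x (Icc 0 T) := by
    apply LipschitzOnWith.of_dist_le_mul
    intro s hs t ht
    exact le_of_tendsto ((hx s hs).dist (hx t ht))
      (Filter.Eventually.of_forall fun k => (hXL k).dist_le_mul s hs t ht)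
  refine ⟨x, ⟨C, hxL⟩, ?_, ?_⟩
  · have h0 : (0:ℝ) ∈ Icc 0 T := ⟨le_rfl, hT.le⟩
    have := hx 0 h0
    simp only [hX0] at this
    exact tendsto_nhds_unique this tendsto_const_nhds
  · filter_upwards [hxL.ae_differentiableWithinAt_of_mem_real] with t ht htI
    have htI' := Ioo_subset_Icc_self htI
    have hD : HasDerivAt x (deriv x t) t :=
      ((ht htI').differentiableAt (Icc_mem_nhds htI.1 htI.2)).hasDerivAt
    refine ⟨deriv x t, ?_, hD⟩
    by_contra hnot
    obtain ⟨l, u, hlu, hul⟩ := geometric_hahn_banach_closed_point (hcv t (x t)) (hcl t (x t)) hnot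
    have hev := hU t htI (x t) l u hlu
    rw [Filter.eventually_prod_iff] at hev
    obtain ⟨pa, hpa, pb, hpb, hab⟩ := hev
    rw [Metric.eventually_nhds_iff] at hpa
    obtain ⟨ε, hε, hpa⟩ := hpa
    -- time window
    obtain ⟨δ, hδ, hδε, hδT, hδC⟩ : ∃ δ > 0, δ < ε ∧ t + δ < T ∧ C * δ < ε / 2 := by
      refine ⟨min (min (ε / 2) ((T - t) / 2)) (ε / 2 / (C + 1) / 2), ?_, ?_, ?_, ?_⟩
      · have := htI.2
        have : 0 < T - t := by linarith
        positivity
      · have := min_le_left (min (ε / 2) ((T - t) / 2)) (ε / 2 / (C + 1) / 2)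
        have := min_le_left (ε / 2) ((T - t) / 2)
        linarith
      · have := min_le_left (min (ε / 2) ((T - t) / 2)) (ε / 2 / (C + 1) / 2)
        have := min_le_right (ε / 2) ((T - t) / 2)
        have := htI.2
        linarith
      · have h1 := min_le_right (min (ε / 2) ((T - t) / 2)) (ε / 2 / (C + 1) / 2)
        have hC : (0:ℝ) ≤ C := C.2
        calc (C:ℝ) * _ ≤ C * (ε / 2 / (C + 1) / 2) := by gcongr
          _ ≤ (C + 1) * (ε / 2 / (C + 1) / 2) := by gcongr; linarith
          _ = ε / 4 := by field_simp; norm_num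
          _ < ε / 2 := by linarith
    have key : ∀ r ∈ Ioo 0 δ, l (x (t + r)) - l (x t) ≤ u * r := by
      intro r hr
      have hrI : t + r ∈ Icc 0 T := ⟨by linarith [htI.1, hr.1], by linarith [hr.2]⟩
      have hT1 : Filter.Tendsto (fun k => l (X k (t + r)) - l (X k t)) U
          (nhds (l (x (t + r)) - l (x t))) :=
        ((l.continuous.tendsto _).comp (hx _ hrI)).sub ((l.continuous.tendsto _).comp (hx _ htI'))
      apply le_of_tendsto hT1
      have e1 : ∀ᶠ k in (U : Filter ℕ), dist (X k t) (x t) < ε / 2 :=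
        (hx t htI').eventually (Metric.ball_mem_nhds _ (by positivity))
      filter_upwards [e1, hUat hpb] with k hk1 hk2
      have hsub : Icc t (t + r) ⊆ Icc 0 T := Icc_subset_Icc htI'.1 hrI.2
      have hder : ∀ s ∈ Ioo t (t + r), HasDerivAt (fun s => l (X k s)) (l (F k s (X k s))) s := by
        intro s hs
        have hs0 : s ∈ Ioo 0 T := ⟨htI.1.trans hs.1, hs.2.trans_le hrI.2⟩
        exact l.hasFDerivAt.comp_hasDerivAt s
          ((hXd k s (Ioo_subset_Icc_self hs0)).hasDerivAt (Icc_mem_nhds hs0.1 hs0.2))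
      have := (convex_Icc t (t + r)).image_sub_le_mul_sub_of_deriv_le
        (f := fun s => l (X k s)) (C := u)
        (l.continuous.comp_continuousOn ((hXL k).continuousOn.mono hsub))
        (by
          rw [interior_Icc]
          intro s hs
          exact (hder s hs).differentiableAt.differentiableWithinAt)
        (by
          rw [interior_Icc]
          intro s hs
          rw [(hder s hs).deriv]
          refine (hab (x := (s, X k s)) (hpa ?_) hk2).le
          have hst : dist s t ≤ δ := by
            rw [Real.dist_eq, abs_of_pos (by linarith [hs.1])]
            linarith [hs.2, hr.2]
          rw [Prod.dist_eq]
          refine max_lt (hst.trans_lt hδε) ?_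
          have h3 := (hXL k).dist_le_mul s (hsub (Ioo_subset_Icc_self hs)) t htI'
          have h4 : (C:ℝ) * dist s t ≤ C * δ := by gcongr
          have h5 := dist_triangle (X k s) (X k t) (x t)
          show dist (X k s) (x t) < ε
          linarith)
        t ⟨le_rfl, by linarith [hr.1]⟩ (t + r) ⟨by linarith [hr.1], le_rfl⟩ (by linarith [hr.1])
      simpa using this
    have hlD : HasDerivAt (fun s => l (x s)) (l (deriv x t)) t :=
      l.hasFDerivAt.comp_hasDerivAt t hD
    have hslope := hasDerivWithinAt_iff_tendsto_slope.1 (hlD.hasDerivWithinAt (s := Ioi t))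
    have : l (deriv x t) ≤ u := by
      have hne : (nhdsWithin t (Ioi t \ {t})).NeBot := by
        rw [sdiff_singleton_eq_self (by simp)]; infer_instance
      apply le_of_tendsto hslope
      rw [sdiff_singleton_eq_self (by simp)]
      filter_upwards [Ioo_mem_nhdsGT (show t < t + δ by linarith)] with s hs
      have := key (s - t) ⟨by linarith [hs.1], by linarith [hs.2]⟩
      rw [slope_def_field, div_le_iff₀ (by linarith [hs.1])]
      simpa using this
    linarith

lemma mv_eq_sum {n m : ℕ} (M : Matrix (Fin n) (Fin m) ℝ) (s : EuclideanSpace ℝ (Fin m)) :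
    mv M s = ∑ i, s i • col M i := by
  ext j
  simp [mv, col, mul_comm]

lemma sgnSet_subset (x : ℝ) : sgnSet x ⊆ Icc (-1) 1 := by
  unfold sgnSet
  split_ifs <;> simp

lemma sgnSet_nonempty (x : ℝ) : (sgnSet x).Nonempty := by
  unfold sgnSet
  split_ifs <;> simp

lemma sgnSet_convex (x : ℝ) : Convex ℝ (sgnSet x) := by
  unfold sgnSet
  split_ifs
  · exact convex_singleton _
  · exact convex_singleton _
  · exact convex_Icc _ _

lemma sgnSet_compact (x : ℝ) : IsCompact (sgnSet x) := by
  unfold sgnSet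
  split_ifs
  · exact isCompact_singleton
  · exact isCompact_singleton
  · exact isCompact_Icc

lemma SgnSet_compact {m : ℕ} (y : EuclideanSpace ℝ (Fin m)) : IsCompact (SgnSet y) := by
  have h1 : IsCompact (Set.pi univ fun i => sgnSet (y i)) :=
    isCompact_univ_pi fun i => sgnSet_compact _
  have h2 := h1.image (PiLp.continuous_toLp 2 (fun _ : Fin m => ℝ))
  convert h2
  ext s
  constructor
  · intro hs
    exact ⟨fun i => s i, fun i _ => hs i, rfl⟩
  · rintro ⟨w, hw, rfl⟩ i
    exact hw i trivial

lemma SgnSet_convex {m : ℕ} (y : EuclideanSpace ℝ (Fin m)) : Convex ℝ (SgnSet y) := by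
  intro s hs s' hs' a b ha hb hab i
  exact sgnSet_convex _ (hs i) (hs' i) ha hb hab

lemma SgnSet_nonempty {m : ℕ} (y : EuclideanSpace ℝ (Fin m)) : (SgnSet y).Nonempty := by
  choose s hs using fun i => sgnSet_nonempty (y i)
  exact ⟨WithLp.toLp 2 s, hs⟩

/-- A smooth approximation of the sign function. -/
def smoothSgn (y : ℝ) : ℝ := 2 * Real.smoothTransition ((y + 1) / 2) - 1

lemma smoothSgn_contDiff : ContDiff ℝ (⊤ : ℕ∞) smoothSgn := by
  unfold smoothSgn
  have := Real.smoothTransition.contDiff (n := ⊤)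
  fun_prop

lemma smoothSgn_mem (y : ℝ) : smoothSgn y ∈ Icc (-1 : ℝ) 1 := by
  have h1 := Real.smoothTransition.le_one ((y + 1) / 2)
  have h2 := Real.smoothTransition.nonneg ((y + 1) / 2)
  unfold smoothSgn
  constructor <;> linarith

lemma smoothSgn_of_one_le {y : ℝ} (h : 1 ≤ y) : smoothSgn y = 1 := by
  unfold smoothSgn
  rw [Real.smoothTransition.one_of_one_le (by linarith)]; norm_num

lemma smoothSgn_of_le {y : ℝ} (h : y ≤ -1) : smoothSgn y = -1 := by
  unfold smoothSgn
  rw [Real.smoothTransition.zero_of_nonpos (by linarith)]; norm_num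

lemma smoothSgn_limit {α : Type*} (W : Ultrafilter α) (k : α → ℕ) (a : α → ℝ) (c : ℝ)
    (hk : Filter.Tendsto k W Filter.atTop) (ha : Filter.Tendsto a W (nhds c)) :
    ∃ s ∈ sgnSet c, Filter.Tendsto (fun p => smoothSgn (k p * a p)) W (nhds s) := by
  have hk' : Filter.Tendsto (fun p => (k p : ℝ)) W Filter.atTop :=
    tendsto_natCast_atTop_atTop.comp hk
  rcases lt_trichotomy c 0 with hc | hc | hc
  · refine ⟨-1, by simp [sgnSet, hc, not_lt.2 hc.le], ?_⟩
    apply tendsto_const_nhds.congr'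
    filter_upwards [(hk'.atTop_mul_neg hc ha).eventually_le_atBot (-1)] with p hp
    rw [smoothSgn_of_le hp]
  · obtain ⟨s, hs, hW⟩ := (isCompact_Icc (a := (-1:ℝ)) (b := 1)).ultrafilter_le_nhds
      (W.map (fun p => smoothSgn (k p * a p))) (by
        rw [Filter.le_principal_iff]
        apply Filter.mem_map.2
        apply Filter.univ_mem'
        intro p
        exact smoothSgn_mem _)
    exact ⟨s, by simpa [sgnSet, hc] using hs, hW⟩
  · refine ⟨1, by simp [sgnSet, hc], ?_⟩
    apply tendsto_const_nhds.congr'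
    filter_upwards [(hk'.atTop_mul_pos hc ha).eventually_ge_atTop 1] with p hp
    rw [smoothSgn_of_one_le hp]

section cutoff

lemma f_continuousAt {E : Type*} [NormedAddCommGroup E] [NormedSpace ℝ E] {T : ℝ}
    {f : ℝ → E → E} {L : ℝ}
    (hL : ∀ t ∈ Icc (0 : ℝ) T, ∀ x₁ x₂ : E, ‖f t x₁ - f t x₂‖ ≤ L * ‖x₁ - x₂‖)
    (hd : ∀ x : E, Differentiable ℝ fun t => f t x) {t : ℝ} (ht : t ∈ Ioo 0 T) (z : E) :
    Filter.Tendsto (fun p : ℝ × E => f p.1 p.2) (nhds (t, z)) (nhds (f t z)) := by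
  have h1 : Filter.Tendsto (fun p : ℝ × E => f p.1 z) (nhds (t, z)) (nhds (f t z)) :=
    ((hd z).continuous.tendsto t).comp (continuous_fst.tendsto (t, z))
  have h2 : Filter.Tendsto (fun p : ℝ × E => f p.1 p.2 - f p.1 z) (nhds (t, z)) (nhds 0) := by
    have h3 : Filter.Tendsto (fun p : ℝ × E => L * ‖p.2 - z‖) (nhds (t, z)) (nhds 0) := by
      have : Continuous (fun p : ℝ × E => L * ‖p.2 - z‖) := by fun_prop
      simpa using this.tendsto (t, z)
    apply squeeze_zero_norm' _ h3
    have h4 : ∀ᶠ p : ℝ × E in nhds (t, z), p.1 ∈ Icc 0 T :=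
      (continuous_fst.tendsto (t, z)).eventually (Icc_mem_nhds ht.1 ht.2)
    filter_upwards [h4] with p hp
    exact hL _ hp _ _
  simpa using h2.add h1

lemma cutoff_solution {n m : ℕ} {T : ℝ} (hT : 0 < T)
    {f : ℝ → EuclideanSpace ℝ (Fin n) → EuclideanSpace ℝ (Fin n)}
    {L : ℝ} (hL0 : 0 ≤ L)
    (hL : ∀ t ∈ Icc (0 : ℝ) T, ∀ x₁ x₂, ‖f t x₁ - f t x₂‖ ≤ L * ‖x₁ - x₂‖)
    (hd : ∀ x, Differentiable ℝ fun t => f t x)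
    {g : EuclideanSpace ℝ (Fin n) → Matrix (Fin n) (Fin m) ℝ}
    {h : EuclideanSpace ℝ (Fin n) → EuclideanSpace ℝ (Fin m)}
    (hg : ∀ (i : Fin n) (j : Fin m), ContDiff ℝ (⊤ : ℕ∞) fun ξ => g ξ i j)
    (hh : ContDiff ℝ (⊤ : ℕ∞) h)
    (χ : EuclideanSpace ℝ (Fin n) → ℝ) (ρ : ℝ) (hρ : 0 ≤ ρ)
    (hχ : ContDiff ℝ (⊤ : ℕ∞) χ) (hχc : HasCompactSupport χ)
    (hχ0 : ∀ x, 0 ≤ χ x) (hχ1 : ∀ x, χ x ≤ 1) (hχρ : ∀ x, ρ < ‖x‖ → χ x = 0)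
    (x₀ : EuclideanSpace ℝ (Fin n)) :
    ∃ x, IsLipschitzSolution
      (fun t ξ => {v | ∃ s ∈ SgnSet (h ξ), v = χ ξ • (f t ξ - mv (g ξ) s)}) T x₀ x := by
  have hcol : ∀ i, ContDiff ℝ (⊤ : ℕ∞) (fun ξ => col (g ξ) i) := by
    intro i
    rw [contDiff_euclidean]
    intro j
    exact hg j i
  have hhi : ∀ i, ContDiff ℝ (⊤ : ℕ∞) (fun ξ => h ξ i) := fun i => contDiff_euclidean.1 hh i
  let Φ : ℕ → EuclideanSpace ℝ (Fin n) → EuclideanSpace ℝ (Fin n) :=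
    fun k y => ∑ i, smoothSgn (k * h y i) • col (g y) i
  have hΦ : ∀ k, ContDiff ℝ (⊤ : ℕ∞) (Φ k) := by
    intro k
    apply ContDiff.sum
    intro i _
    exact (smoothSgn_contDiff.comp (contDiff_const.mul (hhi i))).smul (hcol i)
  -- bounds
  obtain ⟨C0, hC0⟩ : ∃ C0, ∀ t ∈ Icc 0 T, ‖f t 0‖ ≤ C0 :=
    isCompact_Icc.exists_bound_of_continuousOn (hd 0).continuous.continuousOn
  have hC0n : 0 ≤ C0 := (norm_nonneg _).trans (hC0 0 ⟨le_rfl, hT.le⟩)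
  have hfD : ∀ t ∈ Icc 0 T, ∀ x, ‖x‖ ≤ ρ → ‖f t x‖ ≤ C0 + L * ρ := by
    intro t ht x hx
    have h1 := hL t ht x 0
    rw [sub_zero] at h1
    have h2 := norm_sub_norm_le (f t x) (f t 0)
    have h3 : L * ‖x‖ ≤ L * ρ := by gcongr
    linarith [hC0 t ht]
  obtain ⟨G, hG⟩ : ∃ G, ∀ y ∈ Metric.closedBall (0 : EuclideanSpace ℝ (Fin n)) ρ,
      ‖∑ i, ‖col (g y) i‖‖ ≤ G :=
    (isCompact_closedBall _ _).exists_bound_of_continuousOn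
      (continuous_finsetSum _ fun i _ => (hcol i).continuous.norm).continuousOn
  have hΦG : ∀ k y, ‖y‖ ≤ ρ → ‖Φ k y‖ ≤ G := by
    intro k y hy
    calc ‖Φ k y‖ ≤ ∑ i, ‖smoothSgn (k * h y i) • col (g y) i‖ := norm_sum_le _ _
      _ ≤ ∑ i, ‖col (g y) i‖ := by
        apply Finset.sum_le_sum
        intro i _
        rw [norm_smul]
        apply mul_le_of_le_one_left (norm_nonneg _)
        rw [Real.norm_eq_abs]
        exact abs_le.2 (smoothSgn_mem _)
      _ ≤ ‖∑ i, ‖col (g y) i‖‖ := le_abs_self _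
      _ ≤ G := hG y (by simpa using hy)
  have hGn : 0 ≤ G := (norm_nonneg _).trans (hΦG 0 0 (by simpa using hρ))
  have hDn : 0 ≤ C0 + L * ρ := by positivity
  obtain ⟨A, hA⟩ := ContDiff.lipschitzWith_of_hasCompactSupport hχc hχ (by simp)
  apply exists_limit_solution hT (fun k t y => χ y • (f t y - Φ k y))
    ⟨C0 + L * ρ + G, by positivity⟩
  · intro k t ht x
    show _ ≤ C0 + L * ρ + G
    by_cases hx : ρ < ‖x‖
    · rw [hχρ x hx]; simp; positivity
    · push Not at hx
      rw [norm_smul, Real.norm_eq_abs, abs_of_nonneg (hχ0 x)]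
      refine (mul_le_of_le_one_left (norm_nonneg _) (hχ1 x)).trans ?_
      exact (norm_sub_le _ _).trans (add_le_add (hfD t ht x hx) (hΦG k x hx))
  · intro k
    have hcs : HasCompactSupport (fun y => χ y • Φ k y) := hχc.smul_right
    obtain ⟨B, hB⟩ := ContDiff.lipschitzWith_of_hasCompactSupport hcs (hχ.smul (hΦ k)) (by simp)
    refine ⟨⟨L + A * (C0 + L * ρ), by positivity⟩ + B, fun t ht => ?_⟩
    have hf : LipschitzWith ⟨L + A * (C0 + L * ρ), by positivity⟩ (fun y => χ y • f t y) := by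
      have half : ∀ x y, ‖x‖ ≤ ρ → dist (χ x • f t x) (χ y • f t y) ≤
          (L + A * (C0 + L * ρ)) * dist x y := by
        intro x y hx
        have e : χ x • f t x - χ y • f t y = χ y • (f t x - f t y) + (χ x - χ y) • f t x := by
          module
        rw [dist_eq_norm, e]
        have h1 : ‖χ y • (f t x - f t y)‖ ≤ L * dist x y := by
          rw [norm_smul, Real.norm_eq_abs, abs_of_nonneg (hχ0 y), dist_eq_norm]
          exact (mul_le_of_le_one_left (norm_nonneg _) (hχ1 y)).trans (hL t ht x y)
        have h2 : ‖(χ x - χ y) • f t x‖ ≤ A * dist x y * (C0 + L * ρ) := by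
          rw [norm_smul, ← dist_eq_norm]
          exact mul_le_mul (hA.dist_le_mul x y) (hfD t ht x hx) (norm_nonneg _) (by positivity)
        refine (norm_add_le _ _).trans ((add_le_add h1 h2).trans (le_of_eq ?_))
        ring
      apply LipschitzWith.of_dist_le_mul
      intro x y
      show _ ≤ (L + A * (C0 + L * ρ)) * dist x y
      by_cases hx : ρ < ‖x‖
      · by_cases hy : ρ < ‖y‖
        · simp only [hχρ x hx, hχρ y hy, zero_smul, dist_self]; positivity
        · rw [dist_comm, dist_comm x y]
          exact half y x (not_lt.1 hy)
      · exact half x y (not_lt.1 hx)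
    have := hf.sub hB
    simpa only [smul_sub] using this
  · intro k x
    exact ((((hd x).continuous.sub continuous_const)).const_smul (χ x)).continuousOn
  · intro t ξ
    rintro _ ⟨s, hs, rfl⟩ _ ⟨s', hs', rfl⟩ a b ha hb hab
    refine ⟨a • s + b • s', SgnSet_convex _ hs hs' ha hb hab, ?_⟩
    have e : mv (g ξ) (a • s + b • s') = a • mv (g ξ) s + b • mv (g ξ) s' := by
      simp only [mv_eq_sum, Finset.smul_sum, ← Finset.sum_add_distrib]
      refine Finset.sum_congr rfl fun i _ => ?_
      simp only [PiLp.add_apply, PiLp.smul_apply, smul_eq_mul]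
      module
    rw [e]
    obtain rfl : b = 1 - a := by linarith
    module
  · intro t ξ
    have hcont : Continuous (fun s => χ ξ • (f t ξ - mv (g ξ) s)) := by
      simp only [mv_eq_sum]
      fun_prop
    have := ((SgnSet_compact (h ξ)).image hcont).isClosed
    have e : {v | ∃ s ∈ SgnSet (h ξ), v = χ ξ • (f t ξ - mv (g ξ) s)} =
        (fun s => χ ξ • (f t ξ - mv (g ξ) s)) '' SgnSet (h ξ) := by
      refine Set.ext fun v => ⟨?_, ?_⟩
      · rintro ⟨s, hs, rfl⟩
        exact ⟨s, hs, rfl⟩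
      · rintro ⟨s, hs, rfl⟩
        exact ⟨s, hs, rfl⟩
    rw [e]
    exact this
  · intro t ht z l u hlu
    rw [Filter.Eventually, Filter.mem_iff_ultrafilter]
    intro W hW
    have hW1 : Filter.Tendsto (fun p : (ℝ × EuclideanSpace ℝ (Fin n)) × ℕ => p.1) W
        (nhds (t, z)) := Filter.tendsto_fst.mono_left hW
    have hW2 : Filter.Tendsto (fun p : (ℝ × EuclideanSpace ℝ (Fin n)) × ℕ => p.2) W
        Filter.atTop := Filter.tendsto_snd.mono_left hW
    have hWz : Filter.Tendsto (fun p : (ℝ × EuclideanSpace ℝ (Fin n)) × ℕ => p.1.2) W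
        (nhds z) := (continuous_snd.tendsto (t, z)).comp hW1
    choose s hs hst using fun i => smoothSgn_limit W (fun p => p.2) (fun p => h p.1.2 i) (h z i)
      hW2 (((hhi i).continuous.tendsto z).comp hWz)
    have hlim : Filter.Tendsto (fun p : (ℝ × EuclideanSpace ℝ (Fin n)) × ℕ =>
        l (χ p.1.2 • (f p.1.1 p.1.2 - Φ p.2 p.1.2))) W
        (nhds (l (χ z • (f t z - mv (g z) (WithLp.toLp 2 s))))) := by
      refine (l.continuous.tendsto _).comp (Filter.Tendsto.smul
        ((hχ.continuous.tendsto z).comp hWz)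
        (Filter.Tendsto.sub ((f_continuousAt hL hd ht z).comp hW1) ?_))
      rw [mv_eq_sum]
      exact tendsto_finsetSum _ fun i _ =>
        (hst i).smul (((hcol i).continuous.tendsto z).comp hWz)
    exact hlim.eventually (gt_mem_nhds (hlu _ ⟨_, hs, rfl⟩))

end cutoff

lemma one_sided {n m : ℕ} {T L : ℝ}
    {f : ℝ → EuclideanSpace ℝ (Fin n) → EuclideanSpace ℝ (Fin n)}
    (hL : ∀ t ∈ Icc (0 : ℝ) T, ∀ x₁ x₂, ‖f t x₁ - f t x₂‖ ≤ L * ‖x₁ - x₂‖)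
    {g : EuclideanSpace ℝ (Fin n) → Matrix (Fin n) (Fin m) ℝ}
    {h : EuclideanSpace ℝ (Fin n) → EuclideanSpace ℝ (Fin m)}
    {k : Fin m → ℝ}
    (hk : ∀ i, ∀ x y u v : EuclideanSpace ℝ (Fin n),
      u ∈ {w | ∃ σ ∈ sgnSet (h x i), w = σ • col (g x) i} →
      v ∈ {w | ∃ σ ∈ sgnSet (h y i), w = σ • col (g y) i} →
      -(k i * ‖x - y‖ ^ 2) ≤ ⟪u - v, x - y⟫)
    {t : ℝ} (ht : t ∈ Icc 0 T) (x y : EuclideanSpace ℝ (Fin n))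
    (s s' : EuclideanSpace ℝ (Fin m)) (hs : s ∈ SgnSet (h x)) (hs' : s' ∈ SgnSet (h y)) :
    ⟪(f t x - mv (g x) s) - (f t y - mv (g y) s'), x - y⟫ ≤ (L + ∑ i, k i) * ‖x - y‖ ^ 2 := by
  have e : (f t x - mv (g x) s) - (f t y - mv (g y) s') =
      (f t x - f t y) - ∑ i, (s i • col (g x) i - s' i • col (g y) i) := by
    rw [Finset.sum_sub_distrib, ← mv_eq_sum, ← mv_eq_sum]; abel
  rw [e, inner_sub_left, sum_inner]
  have h1 : ⟪f t x - f t y, x - y⟫ ≤ L * ‖x - y‖ ^ 2 := by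
    refine (real_inner_le_norm _ _).trans ?_
    have := mul_le_mul_of_nonneg_right (hL t ht x y) (norm_nonneg (x - y))
    linarith
  have h2 : ∑ i, -(k i * ‖x - y‖ ^ 2) ≤
      ∑ i, ⟪s i • col (g x) i - s' i • col (g y) i, x - y⟫ :=
    Finset.sum_le_sum fun i _ => hk i x y _ _ ⟨s i, hs i, rfl⟩ ⟨s' i, hs' i, rfl⟩
  rw [Finset.sum_neg_distrib, ← Finset.sum_mul] at h2
  linarith

/-- Well-posedness of `ẋ(t) ∈ f(t,x(t)) - g(x(t))·Sgn(h(x(t)))` for smooth `g, h`: if each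
set-valued map `x ↦ g_{•i}(x)·sgn(hᵢ(x))` is hypomonotone and `f` satisfies Assumptions
(ii)-(iii), then there is a unique Lipschitz solution on `[0,T]` for every initial
condition. -/
theorem smooth_sgn_inclusion_existsUnique_lipschitzSolution
    (n m : ℕ) (T : ℝ) (hT : 0 < T)
    (f : ℝ → EuclideanSpace ℝ (Fin n) → EuclideanSpace ℝ (Fin n))
    (hfII : AssumptionII T f) (hfIII : AssumptionIII T f)
    (g : EuclideanSpace ℝ (Fin n) → Matrix (Fin n) (Fin m) ℝ)
    (h : EuclideanSpace ℝ (Fin n) → EuclideanSpace ℝ (Fin m))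
    (hg : ∀ (i : Fin n) (j : Fin m), ContDiff ℝ (⊤ : ℕ∞) fun ξ => g ξ i j)
    (hh : ContDiff ℝ (⊤ : ℕ∞) h)
    (hHypo : ∀ i : Fin m, Hypomonotone
      (fun ξ => {w | ∃ σ ∈ sgnSet (h ξ i), w = σ • col (g ξ) i}))
    (x₀ : EuclideanSpace ℝ (Fin n)) :
    ∃ x : ℝ → EuclideanSpace ℝ (Fin n),
      IsLipschitzSolution
        (fun t ξ => {v | ∃ s ∈ SgnSet (h ξ), v = f t ξ - mv (g ξ) s}) T x₀ x ∧
      ∀ y : ℝ → EuclideanSpace ℝ (Fin n),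
        IsLipschitzSolution
          (fun t ξ => {v | ∃ s ∈ SgnSet (h ξ), v = f t ξ - mv (g ξ) s}) T x₀ y →
        ∀ t ∈ Icc (0 : ℝ) T, y t = x t := by
  obtain ⟨L, hL0, hL⟩ := hfII
  have hd := hfIII.1
  choose k hk0 hk using hHypo
  have hK0 : 0 ≤ ∑ i, k i := Finset.sum_nonneg fun i _ => hk0 i
  obtain ⟨C0, hC0⟩ : ∃ C0, ∀ t ∈ Icc 0 T, ‖f t 0‖ ≤ C0 :=
    isCompact_Icc.exists_bound_of_continuousOn (hd 0).continuous.continuousOn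
  have hC0n : 0 ≤ C0 := (norm_nonneg _).trans (hC0 0 ⟨le_rfl, hT.le⟩)
  obtain ⟨s0, hs0⟩ := SgnSet_nonempty (h 0)
  set D : ℝ := C0 + ‖mv (g 0) s0‖ with hD
  have hDn : 0 ≤ D := by positivity
  set c : ℝ := L + ∑ i, k i + D with hc
  have hcn : 0 ≤ c := by positivity
  -- one-sided growth estimate
  have hgrow : ∀ t ∈ Icc 0 T, ∀ ξ, ∀ s ∈ SgnSet (h ξ),
      ⟪f t ξ - mv (g ξ) s, ξ⟫ ≤ c * (‖ξ‖ ^ 2 + 1) := by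
    intro t ht ξ s hs
    have h1 := one_sided hL hk ht ξ 0 s s0 hs hs0
    rw [sub_zero, inner_sub_left] at h1
    have h2 : ⟪f t 0 - mv (g 0) s0, ξ⟫ ≤ D * ‖ξ‖ := by
      refine (real_inner_le_norm _ _).trans ?_
      gcongr
      exact (norm_sub_le _ _).trans (add_le_add (hC0 t ht) le_rfl)
    have h3 : D * ‖ξ‖ ≤ D * (‖ξ‖ ^ 2 + 1) := by
      gcongr
      nlinarith [sq_nonneg (‖ξ‖ - 1), norm_nonneg ξ]
    have h4 : 0 ≤ L + ∑ i, k i := by positivity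
    rw [hc]
    nlinarith
  set M : ℝ := Real.exp (2 * c * T) * (‖x₀‖ ^ 2 + 1) with hM
  have hMn : 0 < M := by positivity
  let χ : ContDiffBump (0 : EuclideanSpace ℝ (Fin n)) :=
    ⟨M + 1, M + 2, by linarith, by linarith⟩
  obtain ⟨x, ⟨K, hxK⟩, hx0, hxd⟩ := cutoff_solution hT hL0 hL hd hg hh χ (M + 2) (by linarith)
    χ.contDiff χ.hasCompactSupport (fun _ => χ.nonneg) (fun _ => χ.le_one)
    (fun y hy => χ.zero_of_le_dist (by rw [dist_zero_right]; exact hy.le)) x₀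
  have hbd : ∀ t ∈ Icc 0 T, ‖x t‖ ≤ M + 1 := by
    intro t ht
    have h1 := gronwall_ae hT hxK c 1 (by
      filter_upwards [hxd] with t ht htI
      obtain ⟨v, ⟨s, hs, rfl⟩, hv⟩ := ht htI
      refine ⟨_, hv, ?_⟩
      rw [real_inner_smul_left]
      have h1 := hgrow t (Ioo_subset_Icc_self htI) (x t) s hs
      have h2 : 0 ≤ c * (‖x t‖ ^ 2 + 1) := by positivity
      have h3 := χ.nonneg (x := x t)
      have h4 := χ.le_one (x := x t)
      exact (mul_le_mul_of_nonneg_left h1 h3).trans (mul_le_of_le_one_left h2 h4)) t ht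
    rw [hx0] at h1
    have h2 : Real.exp (2 * c * t) * (‖x₀‖ ^ 2 + 1) ≤ M := by
      rw [hM]
      gcongr
      exact ht.2
    nlinarith [sq_nonneg (‖x t‖ - 1), norm_nonneg (x t)]
  refine ⟨x, ⟨⟨K, hxK⟩, hx0, ?_⟩, ?_⟩
  · filter_upwards [hxd] with t ht htI
    obtain ⟨v, ⟨s, hs, rfl⟩, hv⟩ := ht htI
    refine ⟨_, ⟨s, hs, rfl⟩, ?_⟩
    have h1 : χ (x t) = 1 := χ.one_of_mem_closedBall (by
      rw [mem_closedBall_zero_iff]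
      exact hbd t (Ioo_subset_Icc_self htI))
    rwa [h1, one_smul] at hv
  · rintro y ⟨⟨K', hyK⟩, hy0, hyd⟩ t ht
    have h1 := gronwall_ae hT (hyK.sub hxK) (L + ∑ i, k i) 0 (by
      filter_upwards [hxd, hyd] with t htx hty htI
      obtain ⟨v, ⟨s, hs, rfl⟩, hv⟩ := htx htI
      obtain ⟨w, ⟨s', hs', rfl⟩, hw⟩ := hty htI
      have h1 : χ (x t) = 1 := χ.one_of_mem_closedBall (by
        rw [mem_closedBall_zero_iff]
        exact hbd t (Ioo_subset_Icc_self htI))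
      rw [h1, one_smul] at hv
      refine ⟨_, hw.sub hv, ?_⟩
      rw [add_zero]
      exact one_sided hL hk (Ioo_subset_Icc_self htI) (y t) (x t) s' s hs' hs) t ht
    simp only [hy0, hx0, sub_self, norm_zero, add_zero] at h1
    have h2 : ‖y t - x t‖ ^ 2 ≤ 0 := by simpa using h1
    have h3 : ‖y t - x t‖ = 0 := by
      have := sq_nonneg ‖y t - x t‖
      exact pow_eq_zero_iff (two_ne_zero) |>.1 (le_antisymm h2 this)
    exact sub_eq_zero.1 (norm_eq_zero.1 h3)
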